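/- For every even integer k ≥ 10, the graph G_k has exactly 8k + 1 vertices and is not Hamiltonian, i.e., it contains no cycle visiting every vertex exactly once. -/

import Mathlib

open SimpleGraph

/-- Vertex type of the graph `H_k`: four disjoint families
`b_i` (`i` mod `k`), `u_j` (`j` mod `3k`), `v_j` (`j` mod `3k`), `a_i` (`i` mod `k`). -/
inductive HkV (k : ℕ) : Type where
  | b : ZMod k → HkV k
  | u : ZMod (3 * k) → HkV k
  | v : ZMod (3 * k) → HkV k
  | a : ZMod k → HkV k
deriving DecidableEq

/-- The natural map sending the residue `i` mod `k` to the residue `3 i` mod `3 k`. -/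
def HkV.tr (k : ℕ) (i : ZMod k) : ZMod (3 * k) := 3 * (i.val : ZMod (3 * k))

/-- The base edge relation of `H_k`: the four cycles
`b_1 ⋯ b_k`, `u_1 ⋯ u_{3k}`, `v_1 ⋯ v_{3k}`, `a_1 ⋯ a_k`, together with the edges
`b_i u_{3i-2}`, `b_i u_{3i}`, `b_i u_{3i+2}`, the edges `u_j v_{j-1}`, `u_j v_{j+1}`,
and the edges `a_i v_{3i-2}`, `a_i v_{3i}`, `a_i v_{3i+2}` (indices modulo `k`
resp. `3k`). -/
def hkRel (k : ℕ) : HkV k → HkV k → Prop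
  | .b i, .b i' => i' = i + 1
  | .u j, .u j' => j' = j + 1
  | .v j, .v j' => j' = j + 1
  | .a i, .a i' => i' = i + 1
  | .b i, .u j => j = HkV.tr k i - 2 ∨ j = HkV.tr k i ∨ j = HkV.tr k i + 2
  | .u j, .v j' => j' = j - 1 ∨ j' = j + 1
  | .a i, .v j => j = HkV.tr k i - 2 ∨ j = HkV.tr k i ∨ j = HkV.tr k i + 2
  | _, _ => False

/-- The graph `H_k` from the paper. -/
def Hk (k : ℕ) : SimpleGraph (HkV k) := SimpleGraph.fromRel (hkRel k)
/-- The base edge relation of `G_k`: the relation of `H_k` on the old vertices, together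
with edges joining the new vertex (`none`) to `b_1, b_3, b_5, b_7, b_9`. -/
def gkRel (k : ℕ) : Option (HkV k) → Option (HkV k) → Prop
  | some x, some y => hkRel k x y
  | none, some (.b i) => i = 1 ∨ i = 3 ∨ i = 5 ∨ i = 7 ∨ i = 9
  | _, _ => False

/-- The graph `G_k` from the paper: `H_k` together with one new vertex `w = none` whose
neighborhood is exactly `{b_1, b_3, b_5, b_7, b_9}`. -/
def Gk (k : ℕ) : SimpleGraph (Option (HkV k)) := SimpleGraph.fromRel (gkRel k)
/-- An injection of `HkV k` into a sum of `ZMod` types, used to get finiteness. -/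
def HkV.toSum {k : ℕ} : HkV k → ZMod k ⊕ ZMod (3 * k) ⊕ ZMod (3 * k) ⊕ ZMod k
  | .b i => .inl i
  | .u j => .inr (.inl j)
  | .v j => .inr (.inr (.inl j))
  | .a i => .inr (.inr (.inr i))

instance (k : ℕ) [NeZero k] : Finite (HkV k) := by
  haveI : NeZero (3 * k) := ⟨Nat.mul_ne_zero (by norm_num) (NeZero.ne k)⟩
  exact Finite.of_injective HkV.toSum
    (by intro x y h; cases x <;> cases y <;> simp_all [HkV.toSum])

noncomputable instance (k : ℕ) [NeZero k] : Fintype (HkV k) := Fintype.ofFinite _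

/-- The parity homomorphism `ZMod n → ZMod 2` for even `n`. -/
def parity {n : ℕ} (h : 2 ∣ n) : ZMod n →+* ZMod 2 := ZMod.castHom h (ZMod 2)

theorem parity_tr {k : ℕ} [NeZero k] (h : 2 ∣ k) (h' : 2 ∣ 3 * k) (i : ZMod k) :
    parity h' (HkV.tr k i) = parity h i := by
  have hi : parity h i = (i.val : ZMod 2) := by
    conv_lhs => rw [← ZMod.natCast_zmod_val i]
    exact map_natCast _ _
  rw [hi, HkV.tr, map_mul, map_natCast, map_ofNat]
  generalize (i.val : ZMod 2) = x
  revert x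
  decide

/-- The bipartition of `G_k` for even `k`. -/
def gkColor {k : ℕ} (h : 2 ∣ k) : Option (HkV k) → ZMod 2
  | none => 0
  | some (.b i) => parity h i
  | some (.u j) => parity (h.mul_left 3) j + 1
  | some (.v j) => parity (h.mul_left 3) j + 1
  | some (.a i) => parity h i

theorem gkColor_ne_of_gkRel {k : ℕ} [NeZero k] (h : 2 ∣ k) {x y : Option (HkV k)}
    (hxy : gkRel k x y) : gkColor h x ≠ gkColor h y := by
  have h0 : ∀ x : ZMod 2, x ≠ x + 1 := by decide
  have h2 : parity (h.mul_left 3) 2 = 0 := map_ofNat _ 2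
  have h3 : parity h 3 = 1 := map_ofNat _ 3
  have h5 : parity h 5 = 1 := map_ofNat _ 5
  have h7 : parity h 7 = 1 := map_ofNat _ 7
  have h9 : parity h 9 = 1 := map_ofNat _ 9
  have hs : ∀ x : ZMod 2, x - 1 = x + 1 := by decide
  rcases x with _ | x <;> rcases y with _ | y <;> try rcases x with i | i | i | i
  all_goals try rcases y with j | j | j | j
  all_goals simp only [gkRel, hkRel] at hxy
  all_goals try rcases hxy with rfl | rfl | rfl | rfl | rfl
  all_goals simp [gkColor, parity_tr h, h0, h2, h3, h5, h7, h9, hs]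

theorem Gk_colorable_two {k : ℕ} [NeZero k] (h : 2 ∣ k) : (Gk k).Colorable 2 := by
  refine (Coloring.mk (α := ZMod 2) (gkColor h) fun {x y} hxy => ?_).colorable
  rcases ((SimpleGraph.fromRel_adj _ _ _).1 hxy).2 with h' | h'
  · exact gkColor_ne_of_gkRel h h'
  · exact (gkColor_ne_of_gkRel h h').symm

/-- The vertex type of `H_k` is a sum of its four families. -/
def HkV.equivSum (k : ℕ) : HkV k ≃ ZMod k ⊕ ZMod (3 * k) ⊕ ZMod (3 * k) ⊕ ZMod k where
  toFun := HkV.toSum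
  invFun := Sum.elim .b (Sum.elim .u (Sum.elim .v .a))
  left_inv x := by cases x <;> rfl
  right_inv x := by rcases x with i | i | i | i <;> rfl

theorem HkV.card_option (k : ℕ) [NeZero k] : Nat.card (Option (HkV k)) = 8 * k + 1 := by
  rw [Finite.card_option, Nat.card_congr (HkV.equivSum k)]
  simp only [Nat.card_sum, Nat.card_zmod]
  ring

/-- for every even integer `k ≥ 10`, the graph `G_k` has exactly
`8k + 1` vertices and is not Hamiltonian. -/
theorem Gk_card_and_not_hamiltonian (k : ℕ) (hk : 10 ≤ k) (hke : Even k) :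
    Nat.card (Option (HkV k)) = 8 * k + 1 ∧
    (haveI : NeZero k := ⟨by omega⟩
     ¬ (Gk k).IsHamiltonian) := by
  have : NeZero k := ⟨by omega⟩
  have hcard := HkV.card_option k
  refine ⟨hcard, fun hH => ?_⟩
  obtain ⟨v, c, hc⟩ := hH (by rw [← Nat.card_eq_fintype_card, hcard]; omega)
  have heven : Even c.length :=
    two_colorable_iff_forall_loop_even.1 (Gk_colorable_two hke.two_dvd) _ c
  rw [hc.length_eq, ← Nat.card_eq_fintype_card, hcard, Nat.even_iff] at heven
  omega
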